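/- arXiv:1608.03482 — 2 statements merged into one kernel-verified Lean document; each statement's English description precedes it below -/
import Mathlib

section
/- Let 𝒞 be an extension-closed pseudovariety of finite groups and let F₁ and F₂ be 𝒞-hereditarily conjugacy separable groups with cyclic centralizers. If G ≤ F₁ × F₂ is a subdirect product such that F₁/N₁ is highly residually-𝒞 and cyclic subgroup 𝒞-separable, where N₁ := G ∩ F₁, then G is 𝒞-hereditarily conjugacy separable. -/
/-- A bundled group (in universe 0). -/
structure GrpB where
  carrier : Type
  str : Group carrier

attribute [instance] GrpB.str

/-- Bundle a group type. -/
def GrpB.of (G : Type) [h : Group G] : GrpB := ⟨G, h⟩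

/-- `C` is a pseudovariety of groups: closed under isomorphism, subgroups,
binary direct products and quotients. -/
def IsPseudovariety (C : GrpB → Prop) : Prop :=
  (∀ A B : GrpB, C A → Nonempty (B.carrier ≃* A.carrier) → C B) ∧
  (∀ (A : GrpB) (H : Subgroup A.carrier), C A → C (GrpB.of H)) ∧
  (∀ A B : GrpB, C A → C B → C (GrpB.of (A.carrier × B.carrier))) ∧
  (∀ (A : GrpB) (N : Subgroup A.carrier) [N.Normal], C A → C (GrpB.of (A.carrier ⧸ N)))

/-- `C` is extension-closed. -/
def IsExtensionClosed (C : GrpB → Prop) : Prop :=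
  ∀ (A : GrpB) (N : Subgroup A.carrier) [N.Normal],
    C (GrpB.of N) → C (GrpB.of (A.carrier ⧸ N)) → C A

/-- Every member of `C` is a finite group. -/
def ClassOfFiniteGroups (C : GrpB → Prop) : Prop := ∀ A : GrpB, C A → Finite A.carrier

/-- `C` contains at least one non-trivial group. -/
def ClassNontrivial (C : GrpB → Prop) : Prop := ∃ A : GrpB, C A ∧ ∃ a : A.carrier, a ≠ 1

/-- `P` is residually-`C`. -/
def ResiduallyC (C : GrpB → Prop) (P : Type) [Group P] : Prop :=
  ∀ p : P, p ≠ 1 → ∃ M : GrpB, C M ∧ ∃ φ : P →* M.carrier, φ p ≠ 1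

/-- `G` is `C`-conjugacy separable. -/
def ConjSepC (C : GrpB → Prop) (G : Type) [Group G] : Prop :=
  ∀ x y : G, ¬ IsConj x y → ∃ M : GrpB, C M ∧ ∃ φ : G →* M.carrier, ¬ IsConj (φ x) (φ y)

/-- `N` is a co-`C` (normal) subgroup of `F`. -/
def IsCoC (C : GrpB → Prop) {F : Type} [Group F] (N : Subgroup F) : Prop :=
  ∃ hn : N.Normal, letI := hn; C (GrpB.of (F ⧸ N))

/-- The pro-`C` topology on `F`: generated by the cosets of co-`C` subgroups. -/
def ProCTop (C : GrpB → Prop) (F : Type) [Group F] : TopologicalSpace F :=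
  TopologicalSpace.generateFrom
    {S : Set F | ∃ N : Subgroup F, IsCoC C N ∧ ∃ g : F, S = {x : F | g⁻¹ * x ∈ N}}

/-- `X` is closed in the pro-`C` topology on `F`. -/
def CClosed (C : GrpB → Prop) {F : Type} [Group F] (X : Set F) : Prop :=
  @IsClosed F (ProCTop C F) X

/-- `X` is open in the pro-`C` topology on `F`. -/
def COpen (C : GrpB → Prop) {F : Type} [Group F] (X : Set F) : Prop :=
  @IsOpen F (ProCTop C F) X

/-- Closure of `X` in the pro-`C` topology on `F`. -/
def CClosure (C : GrpB → Prop) {F : Type} [Group F] (X : Set F) : Set F :=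
  @closure F (ProCTop C F) X

/-- `F` is `C`-hereditarily conjugacy separable: every `C`-open subgroup is
`C`-conjugacy separable. -/
def HerConjSepC (C : GrpB → Prop) (F : Type) [Group F] : Prop :=
  ∀ H : Subgroup F, COpen C (H : Set F) → ConjSepC C H

/-- `M` is cyclic subgroup `C`-separable: every cyclic subgroup is `C`-closed. -/
def CyclicSubgroupSepC (C : GrpB → Prop) (M : Type) [Group M] : Prop :=
  ∀ m : M, CClosed C ((Subgroup.zpowers m : Subgroup M) : Set M)

/-- `M` is highly residually-`C`: every extension of a `C`-group by `M` is residually-`C`. -/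
def HighlyResiduallyC (C : GrpB → Prop) (M : Type) [Group M] : Prop :=
  ∀ (L : Type) [Group L], ∀ (K : Subgroup L) [K.Normal],
    C (GrpB.of K) → Nonempty ((L ⧸ K) ≃* M) → ResiduallyC C L

/-- `F` has cyclic centralizers. -/
def HasCyclicCentralizers (F : Type) [Group F] : Prop :=
  ∀ f : F, f ≠ 1 → IsCyclic (Subgroup.centralizer ({f} : Set F))

/-- `G ≤ F₁ × F₂` is a subdirect product. -/
def IsSubdirect {F₁ F₂ : Type} [Group F₁] [Group F₂] (G : Subgroup (F₁ × F₂)) : Prop :=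
  Subgroup.map (MonoidHom.fst F₁ F₂) G = ⊤ ∧ Subgroup.map (MonoidHom.snd F₁ F₂) G = ⊤

/-- `G ≤ F₁ × F₂` is a full subdirect product. -/
def IsFullSubdirect {F₁ F₂ : Type} [Group F₁] [Group F₂] (G : Subgroup (F₁ × F₂)) : Prop :=
  IsSubdirect G ∧ Subgroup.comap (MonoidHom.inl F₁ F₂) G ≠ ⊥ ∧
    Subgroup.comap (MonoidHom.inr F₁ F₂) G ≠ ⊥

/-- `F` is a free group (of arbitrary rank). -/
def IsFreeGroupType (F : Type) [Group F] : Prop := ∃ S : Type, Nonempty (F ≃* FreeGroup S)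

/-- `F` is a non-abelian free group. -/
def IsNonAbelianFree (F : Type) [Group F] : Prop :=
  IsFreeGroupType F ∧ ∃ a b : F, a * b ≠ b * a

/-- The class of finite `p`-groups. -/
def CP (p : ℕ) : GrpB → Prop := fun A => Finite A.carrier ∧ IsPGroup p A.carrier

/-- The class of all finite groups. -/
def CFin : GrpB → Prop := fun A => Finite A.carrier

/-- A `Q'`-group: every element has finite order coprime to every `q ∈ Q`. -/
def IsQPrimeGroup (Q : Set ℕ) (F : Type) [Group F] : Prop :=
  ∀ f : F, IsOfFinOrder f ∧ ∀ q ∈ Q, Nat.Coprime (orderOf f) q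

namespace GrpB

variable {C : GrpB → Prop}

theorem of_injective (hC : IsPseudovariety C) {A B : Type} [Group A] [Group B]
    (hB : C (GrpB.of B)) (φ : A →* B) (hφ : Function.Injective φ) : C (GrpB.of A) :=
  hC.1 (GrpB.of φ.range) (GrpB.of A) (hC.2.1 (GrpB.of B) φ.range hB)
    ⟨MonoidHom.ofInjective hφ⟩

theorem of_surjective (hC : IsPseudovariety C) {A B : Type} [Group A] [Group B]
    (hA : C (GrpB.of A)) (φ : A →* B) (hφ : Function.Surjective φ) : C (GrpB.of B) :=
  have hn : Subgroup.Normal (G := (GrpB.of A).carrier) φ.ker := MonoidHom.normal_ker φ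
  have hquot := @hC.2.2.2 (GrpB.of A) φ.ker hn hA
  hC.1 (GrpB.of (A ⧸ φ.ker)) (GrpB.of B) hquot
    ⟨(QuotientGroup.quotientKerEquivOfSurjective φ hφ).symm⟩

end GrpB

namespace IsCoC

variable {C : GrpB → Prop} {F F' : Type} [Group F] [Group F']

theorem normal {N : Subgroup F} (h : IsCoC C N) : N.Normal := h.1

theorem ker (hC : IsPseudovariety C) (φ : F →* F') (h : C (GrpB.of F')) : IsCoC C φ.ker :=
  ⟨inferInstance, GrpB.of_injective hC h (QuotientGroup.kerLift φ)
    (QuotientGroup.kerLift_injective φ)⟩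

theorem comap (hC : IsPseudovariety C) (φ : F →* F') {N : Subgroup F'} (h : IsCoC C N) :
    IsCoC C (N.comap φ) := by
  obtain ⟨hn, hN⟩ := h
  have := ker hC ((QuotientGroup.mk' N).comp φ) hN
  rwa [← MonoidHom.comap_ker, QuotientGroup.ker_mk'] at this

theorem map (hC : IsPseudovariety C) (φ : F →* F') (hφ : Function.Surjective φ)
    {N : Subgroup F} (h : IsCoC C N) : IsCoC C (N.map φ) := by
  obtain ⟨hn, hN⟩ := h
  have hn' : (N.map φ).Normal := hn.map φ hφ
  refine ⟨hn', GrpB.of_surjective hC hN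
    (QuotientGroup.map N (N.map φ) φ (Subgroup.le_comap_map φ N)) ?_⟩
  intro q
  obtain ⟨f', rfl⟩ := QuotientGroup.mk_surjective q
  obtain ⟨f, rfl⟩ := hφ f'
  exact ⟨(f : F ⧸ N), rfl⟩

theorem inf (hC : IsPseudovariety C) {N P : Subgroup F} (hN : IsCoC C N) (hP : IsCoC C P) :
    IsCoC C (N ⊓ P) := by
  obtain ⟨hn, hN⟩ := hN
  obtain ⟨hp, hP⟩ := hP
  have := ker hC ((QuotientGroup.mk' N).prod (QuotientGroup.mk' P)) (hC.2.2.1 _ _ hN hP)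
  rwa [MonoidHom.ker_prod, QuotientGroup.ker_mk', QuotientGroup.ker_mk'] at this

theorem top (hC : IsPseudovariety C) (hne : ∃ A, C A) : IsCoC C (⊤ : Subgroup F) := by
  obtain ⟨A, hA⟩ := hne
  have := ker hC (1 : F →* A.carrier) hA
  rwa [MonoidHom.ker_one] at this

theorem iInf (hC : IsPseudovariety C) (hne : ∃ A, C A) {ι : Type*} [Finite ι]
    {N : ι → Subgroup F} (hN : ∀ i, IsCoC C (N i)) : IsCoC C (⨅ i, N i) := by
  have : ∀ s : Set ι, s.Finite → IsCoC C (⨅ i ∈ s, N i) := by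
    intro s hs
    induction s, hs using Set.Finite.induction_on with
    | empty => simpa using top hC hne
    | insert _ _ ih =>
      rw [iInf_insert]
      exact inf hC (hN _) ih
  simpa using this Set.univ Set.finite_univ

theorem finite_quotient (hCfin : ClassOfFiniteGroups C) {N : Subgroup F} (h : IsCoC C N) :
    Finite (F ⧸ N) := by
  obtain ⟨hn, hN⟩ := h
  exact hCfin _ hN

theorem map_mk {N K : Subgroup F} [K.Normal] (hC : IsPseudovariety C)
    (h : IsCoC C (K.subgroupOf N)) : C (GrpB.of (N.map (QuotientGroup.mk' K))) := by
  obtain ⟨hn, h⟩ := h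
  refine GrpB.of_surjective hC h (QuotientGroup.lift (K.subgroupOf N)
    ((QuotientGroup.mk' K).subgroupMap N) ?_) ?_
  · intro x hx
    rw [MonoidHom.mem_ker]
    apply Subtype.ext
    exact (QuotientGroup.eq_one_iff (x : F)).2 (Subgroup.mem_subgroupOf.1 hx)
  · intro y
    obtain ⟨x, rfl⟩ := (QuotientGroup.mk' K).subgroupMap_surjective N y
    exact ⟨(x : N ⧸ K.subgroupOf N), rfl⟩

theorem of_extension (hC : IsPseudovariety C) (hCext : IsExtensionClosed C) {D N : Subgroup F}
    (hD : D.Normal) (hDN : D ≤ N) (hN : IsCoC C N) (h : IsCoC C (D.subgroupOf N)) :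
    IsCoC C D := by
  obtain ⟨hn, hN⟩ := hN
  have hn' : Subgroup.Normal (G := (GrpB.of (F ⧸ D)).carrier) (N.map (QuotientGroup.mk' D)) :=
    hn.map _ (QuotientGroup.mk'_surjective D)
  exact ⟨hD, hCext (GrpB.of (F ⧸ D)) (N.map (QuotientGroup.mk' D)) (map_mk hC h)
    (hC.1 (GrpB.of (F ⧸ N)) _ hN ⟨QuotientGroup.quotientQuotientEquivQuotient D N hDN⟩)⟩

/-- Co-`C` subgroups of subgroups containing a co-`C` subgroup contain co-`C` subgroups of the
ambient group. -/
theorem exists_le (hC : IsPseudovariety C) (hCfin : ClassOfFiniteGroups C)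
    (hCext : IsExtensionClosed C) {N H : Subgroup F} (hN : IsCoC C N) (hNH : N ≤ H)
    {L : Subgroup H} (hL : IsCoC C L) : ∃ D : Subgroup F, IsCoC C D ∧ D ≤ N ∧
      ∀ (d : F) (hd : d ∈ H), d ∈ D → (⟨d, hd⟩ : H) ∈ L := by
  have hne : ∃ A, C A := ⟨_, hN.2⟩
  have hn := hN.normal
  have hP : IsCoC C (L.comap (Subgroup.inclusion hNH)) := hL.comap hC _
  set P := L.comap (Subgroup.inclusion hNH)
  have hPn := hP.normal
  have hfin := hN.finite_quotient hCfin
  have hmem : ∀ f : F, f ∈ (P.map N.subtype).normalCore ↔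
      ∀ q : F ⧸ N, ∃ hf : f ∈ N, MulAut.conjNormal q.out ⟨f, hf⟩ ∈ P := by
    intro f
    have key : ∀ g : F, g * f * g⁻¹ ∈ P.map N.subtype ↔
        ∃ hf : f ∈ N, MulAut.conjNormal g ⟨f, hf⟩ ∈ P := by
      intro g
      constructor
      · rintro ⟨p, hp, hpe⟩
        have hf : f ∈ N := by
          have := hn.conj_mem _ p.2 g⁻¹
          have e : (p : F) = g * f * g⁻¹ := hpe
          rw [e] at this
          simpa [mul_assoc] using this
        refine ⟨hf, ?_⟩
        have : MulAut.conjNormal g ⟨f, hf⟩ = p := Subtype.ext (by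
          rw [MulAut.conjNormal_apply]
          exact hpe.symm)
        rw [this]
        exact hp
      · rintro ⟨hf, h⟩
        exact ⟨_, h, by simp⟩
    constructor
    · intro h q
      exact (key _).1 (h q.out)
    · intro h g
      rw [key]
      obtain ⟨hf, hq⟩ := h (g : F ⧸ N)
      refine ⟨hf, ?_⟩
      have h1 : g * (QuotientGroup.mk g : F ⧸ N).out⁻¹ ∈ N := by
        have := QuotientGroup.eq.1 (QuotientGroup.out_eq' (g : F ⧸ N))
        exact hn.mem_comm this
      have h2 := hPn.conj_mem _ hq ⟨_, h1⟩
      convert h2 using 1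
      apply Subtype.ext
      simp [mul_assoc]
  have hle : (P.map N.subtype).normalCore ≤ N :=
    (Subgroup.normalCore_le _).trans (Subgroup.map_subtype_le P)
  refine ⟨(P.map N.subtype).normalCore, ?_, hle, ?_⟩
  · refine of_extension hC hCext inferInstance hle hN ?_
    have : (P.map N.subtype).normalCore.subgroupOf N =
        ⨅ q : F ⧸ N, P.comap (MulAut.conjNormal q.out : MulAut N).toMonoidHom := by
      ext x
      rw [Subgroup.mem_subgroupOf, hmem, Subgroup.mem_iInf]
      refine forall_congr' fun q => ?_
      simp
    rw [this]
    exact iInf hC hne fun q => hP.comap hC _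
  · intro d hd h
    obtain ⟨p, hp, rfl⟩ := Subgroup.normalCore_le _ h
    exact hp

end IsCoC

section ProC

variable {C : GrpB → Prop} {F F' : Type} [Group F] [Group F']

theorem COpen.exists_isCoC (hC : IsPseudovariety C) (hne : ∃ A, C A) {X : Set F}
    (hX : COpen C X) {x : F} (hx : x ∈ X) :
    ∃ N : Subgroup F, IsCoC C N ∧ ∀ n ∈ N, x * n ∈ X := by
  replace hX : TopologicalSpace.GenerateOpen _ X := hX
  induction hX with
  | basic S hS =>
    obtain ⟨N, hN, g, rfl⟩ := hS
    refine ⟨N, hN, fun n hn => ?_⟩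
    have : g⁻¹ * x ∈ N := hx
    simpa [mul_assoc] using N.mul_mem this hn
  | univ => exact ⟨⊤, IsCoC.top hC hne, fun _ _ => trivial⟩
  | inter S T _ _ ihS ihT =>
    obtain ⟨N, hN, h⟩ := ihS hx.1
    obtain ⟨P, hP, h'⟩ := ihT hx.2
    exact ⟨N ⊓ P, hN.inf hC hP, fun n hn => ⟨h n hn.1, h' n hn.2⟩⟩
  | sUnion S _ ih =>
    obtain ⟨T, hT, hxT⟩ := hx
    obtain ⟨N, hN, h⟩ := ih T hT hxT
    exact ⟨N, hN, fun n hn => ⟨T, hT, h n hn⟩⟩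

theorem IsCoC.cOpen_of_le {N H : Subgroup F} (hN : IsCoC C N) (hNH : N ≤ H) :
    COpen C (H : Set F) := by
  have : (H : Set F) = ⋃ h : H, {x : F | (h : F)⁻¹ * x ∈ N} := by
    ext x
    simp only [SetLike.mem_coe, Set.mem_iUnion, Set.mem_ofPred_eq]
    constructor
    · intro hx
      exact ⟨⟨x, hx⟩, by simp⟩
    · rintro ⟨h, hx⟩
      simpa using H.mul_mem h.2 (hNH hx)
  rw [this]
  let := ProCTop C F
  exact isOpen_iUnion fun h => TopologicalSpace.isOpen_generateFrom_of_mem ⟨N, hN, h, rfl⟩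

/-- Every point outside `X` has a coset neighbourhood in the pro-`C` topology missing `X`. -/
def SeparableC (C : GrpB → Prop) (X : Set F) : Prop :=
  ∀ f ∉ X, ∃ U : Subgroup F, IsCoC C U ∧ ∀ u ∈ U, f * u ∉ X

theorem CClosed.separableC (hC : IsPseudovariety C) (hne : ∃ A, C A) {X : Set F}
    (hX : CClosed C X) : SeparableC C X := by
  intro f hf
  have : COpen C Xᶜ := by
    let := ProCTop C F
    exact IsClosed.isOpen_compl (self := hX)
  exact this.exists_isCoC hC hne hf

namespace SeparableC

theorem comap (hC : IsPseudovariety C) (φ : F →* F') {X : Set F'} (hX : SeparableC C X) :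
    SeparableC C (φ ⁻¹' X) := by
  intro f hf
  obtain ⟨U, hU, h⟩ := hX (φ f) hf
  refine ⟨U.comap φ, hU.comap hC φ, fun u hu => ?_⟩
  have := h (φ u) hu
  rwa [← map_mul] at this

theorem inter {X Y : Set F} (hX : SeparableC C X) (hY : SeparableC C Y) :
    SeparableC C (X ∩ Y) := by
  intro f hf
  by_cases h : f ∈ X
  · obtain ⟨U, hU, h'⟩ := hY f fun hy => hf ⟨h, hy⟩
    exact ⟨U, hU, fun u hu hmem => h' u hu hmem.2⟩
  · obtain ⟨U, hU, h'⟩ := hX f h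
    exact ⟨U, hU, fun u hu hmem => h' u hu hmem.1⟩

theorem iUnion (hC : IsPseudovariety C) (hne : ∃ A, C A) {ι : Type*} [Finite ι] {X : ι → Set F}
    (hX : ∀ i, SeparableC C (X i)) : SeparableC C (⋃ i, X i) := by
  intro f hf
  simp only [Set.mem_iUnion, not_exists] at hf
  choose U hU h using fun i => hX i f (hf i)
  refine ⟨⨅ i, U i, IsCoC.iInf hC hne hU, fun u hu => ?_⟩
  simp only [Set.mem_iUnion, not_exists]
  exact fun i => h i u ((Subgroup.mem_iInf.1 hu) i)

theorem translate {X : Set F} (hX : SeparableC C X) (a b : F) :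
    SeparableC C {f | a * f * b ∈ X} := by
  intro f hf
  obtain ⟨U, hU, h⟩ := hX (a * f * b) hf
  refine ⟨U, hU, fun u hu hmem => ?_⟩
  apply h (b⁻¹ * u * b) (by simpa using hU.normal.conj_mem u hu b⁻¹)
  simpa [mul_assoc] using hmem

end SeparableC

theorem IsCoC.separableC {N : Subgroup F} (hN : IsCoC C N) : SeparableC C (N : Set F) := by
  intro f hf
  exact ⟨N, hN, fun u hu h => hf ((N.mul_mem_cancel_right hu).1 h)⟩

theorem ConjSepC.exists_isCoC (hC : IsPseudovariety C) (h : ConjSepC C F) {x y : F}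
    (hxy : ¬ IsConj x y) : ∃ L : Subgroup F, IsCoC C L ∧ ∀ g : F, g * x * g⁻¹ * y⁻¹ ∉ L := by
  obtain ⟨M, hM, φ, hφ⟩ := h x y hxy
  refine ⟨φ.ker, IsCoC.ker hC φ hM, fun g hg => hφ (isConj_iff.2 ⟨φ g, ?_⟩)⟩
  rw [MonoidHom.mem_ker, map_mul, map_inv, mul_inv_eq_one] at hg
  simpa using hg

theorem conjSepC_of_exists_isCoC
    (h : ∀ x y : F, ¬ IsConj x y →
      ∃ L : Subgroup F, IsCoC C L ∧ ∀ g : F, g * x * g⁻¹ * y⁻¹ ∉ L) : ConjSepC C F := by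
  intro x y hxy
  obtain ⟨L, ⟨hn, hL⟩, h⟩ := h x y hxy
  refine ⟨_, hL, QuotientGroup.mk' L, fun hc => ?_⟩
  obtain ⟨q, hq⟩ := isConj_iff.1 hc
  obtain ⟨g, rfl⟩ := QuotientGroup.mk'_surjective L q
  apply h g
  rw [← QuotientGroup.ker_mk' L, MonoidHom.mem_ker, map_mul, map_inv, mul_inv_eq_one, map_mul,
    map_mul, map_inv]
  exact hq

/-- Hereditarily `C`-conjugacy separable groups satisfy the `C`-centralizer condition. -/
theorem HerConjSepC.centralizer_condition (hC : IsPseudovariety C)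
    (hCfin : ClassOfFiniteGroups C) (hCext : IsExtensionClosed C) (hF : HerConjSepC C F)
    (x : F) {K : Subgroup F} (hK : IsCoC C K) :
    ∃ L : Subgroup F, IsCoC C L ∧ ∀ g : F, g * x * g⁻¹ * x⁻¹ ∈ L →
      ∃ c : F, Commute c x ∧ ∃ k ∈ K, g = c * k := by
  have hne : ∃ A, C A := ⟨_, hK.2⟩
  have hKn := hK.normal
  have hfin := hK.finite_quotient hCfin
  set H : Subgroup F := K ⊔ Subgroup.zpowers x
  have hKH : K ≤ H := le_sup_left
  have hxH : x ∈ H := Subgroup.mem_sup_right (Subgroup.mem_zpowers x)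
  have key : ∀ q : F ⧸ K, ∃ L : Subgroup F, IsCoC C L ∧ ∀ g : F, (g : F ⧸ K) = q →
      g * x * g⁻¹ * x⁻¹ ∈ L → ∃ c : F, Commute c x ∧ ∃ k ∈ K, g = c * k := by
    intro q
    by_cases hq : ∃ c k : F, Commute c x ∧ k ∈ K ∧ q.out = c * k
    · obtain ⟨c, k, hc, hk, e⟩ := hq
      refine ⟨K, hK, fun g hg _ => ⟨c, hc, k * (q.out⁻¹ * g), ?_, ?_⟩⟩
      · refine K.mul_mem hk (QuotientGroup.eq.1 ?_)
        rw [hg, QuotientGroup.out_eq']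
      · rw [← mul_assoc, ← e]; group
    · set z := q.out with hz
      by_cases hmem : z⁻¹ * x * z ∈ H
      · have hnc : ¬ IsConj (⟨x, hxH⟩ : H) ⟨z⁻¹ * x * z, hmem⟩ := by
          intro hcon
          obtain ⟨⟨h, hhH⟩, hh⟩ := isConj_iff.1 hcon
          have hh' : h * x * h⁻¹ = z⁻¹ * x * z := congrArg Subtype.val hh
          obtain ⟨k, hk, w, hw, rfl⟩ := Subgroup.mem_sup_of_normal_left.1 hhH
          have hwx : Commute w x := by
            obtain ⟨i, rfl⟩ := Subgroup.mem_zpowers_iff.1 hw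
            exact (Commute.refl x).zpow_left i
          have hkx : k * x * k⁻¹ = z⁻¹ * x * z := by
            rw [← hh']
            have : w * x * w⁻¹ = x := by rw [hwx.eq]; group
            calc k * x * k⁻¹ = k * (w * x * w⁻¹) * k⁻¹ := by rw [this]
              _ = _ := by group
          refine hq ⟨z * k, k⁻¹, ?_, K.inv_mem hk, by group⟩
          calc z * k * x = z * (k * x * k⁻¹) * k := by group
            _ = x * (z * k) := by rw [hkx]; group
        obtain ⟨L, hL, h⟩ := (hF H (hK.cOpen_of_le hKH)).exists_isCoC hC hnc
        obtain ⟨D, hD, hDK, hDL⟩ := IsCoC.exists_le hC hCfin hCext hK hKH hL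
        refine ⟨D, hD, fun g hg hgx => (h ⟨z⁻¹ * g, ?_⟩ ?_).elim⟩
        · refine hKH (QuotientGroup.eq.1 ?_)
          rw [hg, hz, QuotientGroup.out_eq']
        · have hd : z⁻¹ * g * x * (z⁻¹ * g)⁻¹ * (z⁻¹ * x * z)⁻¹ ∈ D := by
            have := hD.normal.conj_mem _ hgx z⁻¹
            simpa [mul_assoc] using this
          exact hDL _ (hKH (hDK hd)) hd
      · refine ⟨K, hK, fun g hg hgx => (hmem ?_).elim⟩
        have hk : z⁻¹ * g ∈ K := QuotientGroup.eq.1 (by rw [hg, hz, QuotientGroup.out_eq'])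
        have hd : z⁻¹ * g * x * (z⁻¹ * g)⁻¹ * (z⁻¹ * x * z)⁻¹ ∈ K := by
          have := hKn.conj_mem _ hgx z⁻¹
          simpa [mul_assoc] using this
        have h1 : z⁻¹ * g * x * (z⁻¹ * g)⁻¹ ∈ H :=
          H.mul_mem (H.mul_mem (hKH hk) hxH) (H.inv_mem (hKH hk))
        exact H.inv_mem_iff.1 ((H.mul_mem_cancel_left h1).1 (hKH hd))
  choose L hL h using key
  refine ⟨⨅ q, L q, IsCoC.iInf hC hne hL, fun g hg => h g g rfl (Subgroup.mem_iInf.1 hg _)⟩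

/-- In a highly residually-`C` extension, the finite kernel can be separated by a co-`C`
subgroup. -/
theorem HighlyResiduallyC.exists_isCoC (hC : IsPseudovariety C) (hCfin : ClassOfFiniteGroups C)
    {N K : Subgroup F} [N.Normal] [K.Normal] (hKN : K ≤ N)
    (hNK : C (GrpB.of (N.map (QuotientGroup.mk' K)))) (h : HighlyResiduallyC C (F ⧸ N)) :
    ∃ W : Subgroup F, IsCoC C W ∧ K ≤ W ∧ W ⊓ N ≤ K := by
  have hn : (N.map (QuotientGroup.mk' K)).Normal :=
    Subgroup.Normal.map inferInstance _ (QuotientGroup.mk'_surjective K)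
  have hfin : Finite (N.map (QuotientGroup.mk' K)) := hCfin _ hNK
  have hres := h (F ⧸ K) (N.map (QuotientGroup.mk' K)) hNK
    ⟨QuotientGroup.quotientQuotientEquivQuotient K N hKN⟩
  have key : ∀ q : {q : N.map (QuotientGroup.mk' K) // q ≠ 1}, ∃ W : Subgroup F,
      IsCoC C W ∧ K ≤ W ∧ ∀ f : F, (f : F ⧸ K) = q.1 → f ∉ W := by
    rintro ⟨q, hq⟩
    obtain ⟨M, hM, φ, hφ⟩ := hres q (fun h => hq (Subtype.ext h))
    refine ⟨φ.ker.comap (QuotientGroup.mk' K), (IsCoC.ker hC φ hM).comap hC _, ?_, ?_⟩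
    · intro k hk
      have : (k : F ⧸ K) = 1 := (QuotientGroup.eq_one_iff k).2 hk
      change φ (k : F ⧸ K) = 1
      rw [this, map_one]
    · intro f hf hmem
      apply hφ
      rw [← hf]
      exact hmem
  choose W hW hKW h using key
  refine ⟨⨅ q, W q, IsCoC.iInf hC ⟨_, hNK⟩ hW, le_iInf hKW, ?_⟩
  rintro f ⟨hfW, hfN⟩
  by_contra hfK
  refine h ⟨⟨(f : F ⧸ K), f, hfN, rfl⟩, fun he => hfK ?_⟩ f rfl (Subgroup.mem_iInf.1 hfW _)
  exact (QuotientGroup.eq_one_iff f).1 (congrArg Subtype.val he)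

/-- If `F ⧸ N` is cyclic subgroup `C`-separable and highly residually-`C`, the product of a cyclic
subgroup with a subgroup `M` of `N` is separable, provided `M` contains a normal subgroup `K` with
`N / K` in `C`. -/
theorem separableC_zpowers_mul (hC : IsPseudovariety C) (hCfin : ClassOfFiniteGroups C)
    {N K M : Subgroup F} [N.Normal] [K.Normal] (hKM : K ≤ M) (hMN : M ≤ N)
    (hNK : C (GrpB.of (N.map (QuotientGroup.mk' K)))) (h : HighlyResiduallyC C (F ⧸ N))
    (hsep : CyclicSubgroupSepC C (F ⧸ N)) (x : F) :
    SeparableC C {f : F | ∃ k : ℤ, x ^ k * f ∈ M} := by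
  have hne : ∃ A, C A := ⟨_, hNK⟩
  obtain ⟨W, hW, hKW, hWN⟩ := h.exists_isCoC hC hCfin (hKM.trans hMN) hNK
  have hsepN : ∀ z : F, SeparableC C {f : F | ∃ k : ℤ, z ^ k * f ∈ N} := by
    intro z
    convert ((hsep (z : F ⧸ N)).separableC hC hne).comap hC (QuotientGroup.mk' N) using 1
    ext f
    simp only [Set.mem_ofPred_eq, Set.mem_preimage, SetLike.mem_coe, Subgroup.mem_zpowers_iff]
    constructor
    · rintro ⟨k, hk⟩
      refine ⟨-k, ?_⟩
      rw [← QuotientGroup.mk_zpow]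
      exact QuotientGroup.eq.2 (by simpa using hk)
    · rintro ⟨k, hk⟩
      refine ⟨-k, ?_⟩
      rw [← QuotientGroup.mk_zpow] at hk
      simpa using QuotientGroup.eq.1 hk
  have hsepW : ∀ z ∈ W, SeparableC C {f : F | ∃ k : ℤ, z ^ k * f ∈ K} := by
    intro z hz
    convert hW.separableC.inter (hsepN z) using 1
    ext f
    constructor
    · rintro ⟨k, hk⟩
      exact ⟨(W.mul_mem_cancel_left (W.zpow_mem hz k)).1 (hKW hk), k, hMN (hKM hk)⟩
    · rintro ⟨hf, k, hk⟩
      exact ⟨k, hWN ⟨W.mul_mem (W.zpow_mem hz k) hf, hk⟩⟩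
  have hsepK : SeparableC C {f : F | ∃ k : ℤ, x ^ k * f ∈ K} := by
    have hWn := hW.normal
    have hfin := hW.finite_quotient hCfin
    obtain ⟨s, hs, hsW⟩ : ∃ s : ℕ, 0 < s ∧ x ^ s ∈ W :=
      ⟨orderOf (x : F ⧸ W), orderOf_pos _, (QuotientGroup.eq_one_iff _).1 (by
        rw [QuotientGroup.mk_pow, pow_orderOf_eq_one])⟩
    convert SeparableC.iUnion hC hne fun r : Fin s =>
      (hsepW _ hsW).translate (x ^ (r : ℕ)) 1 using 1
    ext f
    simp only [Set.mem_ofPred_eq, Set.mem_iUnion, mul_one]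
    constructor
    · rintro ⟨k, hk⟩
      have hpos : (0 : ℤ) < s := by exact_mod_cast hs
      have h0 := Int.emod_nonneg k hpos.ne'
      have h1 := Int.emod_lt_of_pos k hpos
      refine ⟨⟨(k % s).toNat, by omega⟩, k / s, ?_⟩
      have : (x ^ s) ^ (k / s) * x ^ (k % s).toNat = x ^ k := by
        rw [← zpow_natCast, ← zpow_natCast, ← zpow_mul, ← zpow_add, Int.toNat_of_nonneg h0,
          Int.mul_ediv_add_emod]
      rwa [← mul_assoc, this]
    · rintro ⟨r, k, hk⟩
      refine ⟨s * k + (r : ℕ), ?_⟩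
      rwa [zpow_add, zpow_mul, zpow_natCast, zpow_natCast, mul_assoc]
  have hfin : Finite (M.map (QuotientGroup.mk' K)) := by
    have : Finite (N.map (QuotientGroup.mk' K)) := hCfin _ hNK
    exact Finite.of_injective _ (Subgroup.inclusion_injective (Subgroup.map_mono hMN))
  convert SeparableC.iUnion hC hne fun q : M.map (QuotientGroup.mk' K) =>
    hsepK.translate 1 (q : F ⧸ K).out⁻¹ using 1
  ext f
  simp only [Set.mem_ofPred_eq, Set.mem_iUnion, one_mul, ← mul_assoc]
  constructor
  · rintro ⟨k, hk⟩
    refine ⟨⟨_, _, hk, rfl⟩, k, Subgroup.Normal.mem_comm inferInstance (QuotientGroup.eq.1 ?_)⟩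
    rw [QuotientGroup.out_eq']
    rfl
  · rintro ⟨⟨q, m, hm, rfl⟩, k, hk⟩
    refine ⟨k, ?_⟩
    have h1 : (QuotientGroup.mk' K m).out ∈ M := by
      have : m⁻¹ * (QuotientGroup.mk' K m).out ∈ K := QuotientGroup.eq.1 (by
        rw [QuotientGroup.out_eq']; rfl)
      exact (M.mul_mem_cancel_left (M.inv_mem hm)).1 (hKM this)
    exact (M.mul_mem_cancel_right (M.inv_mem h1)).1 (hKM hk)

theorem HasCyclicCentralizers.exists_zpow (hF : HasCyclicCentralizers F) {x : F} (hx : x ≠ 1) :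
    ∃ (a : F) (m : ℤ), m ≠ 0 ∧ x = a ^ m ∧ ∀ c, Commute c x ↔ ∃ i : ℤ, c = a ^ i := by
  obtain ⟨⟨a, ha⟩, hgen⟩ := hF x hx
  have key : ∀ c, Commute c x ↔ ∃ i : ℤ, c = a ^ i := by
    intro c
    constructor
    · intro hc
      obtain ⟨i, hi⟩ := hgen ⟨c, Subgroup.mem_centralizer_singleton_iff.2 hc⟩
      exact ⟨i, (congrArg Subtype.val hi).symm⟩
    · rintro ⟨i, rfl⟩
      exact Commute.zpow_left (Subgroup.mem_centralizer_singleton_iff.1 ha) i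
  obtain ⟨m, hm⟩ := (key x).1 (Commute.refl x)
  refine ⟨a, m, ?_, hm, key⟩
  rintro rfl
  exact hx (by simpa using hm)

end ProC

section Subdirect

variable {C : GrpB → Prop} {F₁ F₂ G : Type} [Group F₁] [Group F₂] [Group G]

theorem separableC_centralizer_product (hC : IsPseudovariety C) (hne : ∃ A, C A)
    (hcyc₁ : HasCyclicCentralizers F₁) (hcyc₂ : HasCyclicCentralizers F₂)
    (p₁ : G →* F₁) (p₂ : G →* F₂) (H : Subgroup G) {x : G} (hx : x ∈ H)
    (hx₁ : p₁ x ≠ 1) (hx₂ : p₂ x ≠ 1)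
    (hsep : SeparableC C {f : F₁ | ∃ k : ℤ, p₁ x ^ k * f ∈ (H ⊓ p₂.ker).map p₁}) :
    SeparableC C {f : F₁ | ∃ h ∈ H, Commute (f * p₁ h) (p₁ x) ∧ Commute (p₂ h) (p₂ x)} := by
  obtain ⟨a, m, hm, hxa, hca⟩ := hcyc₁.exists_zpow hx₁
  obtain ⟨b, n, hn, hxb, hcb⟩ := hcyc₂.exists_zpow hx₂
  have key : ∀ r : ℤ, ∀ s : ℤ, SeparableC C
      {f : F₁ | ∃ h ∈ H, (∃ k : ℤ, f * p₁ h = a ^ r * p₁ x ^ k) ∧ p₂ h = b ^ s} := by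
    intro r s
    by_cases hs : ∃ h₀ ∈ H, p₂ h₀ = b ^ s
    · obtain ⟨h₀, hh₀, hs⟩ := hs
      convert hsep.translate (a ^ (-r)) (p₁ h₀) using 1
      ext f
      constructor
      · rintro ⟨h, hh, ⟨k, hk⟩, hb⟩
        refine ⟨-k, h⁻¹ * h₀, ⟨H.mul_mem (H.inv_mem hh) hh₀, ?_⟩, ?_⟩
        · change p₂ (h⁻¹ * h₀) = 1
          rw [map_mul, map_inv, hb, hs, inv_mul_cancel]
        · rw [eq_mul_inv_of_mul_eq hk, map_mul, map_inv]
          group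
      · rintro ⟨k, μ, ⟨hμH, hμ⟩, hk⟩
        refine ⟨h₀ * μ⁻¹, H.mul_mem hh₀ (H.inv_mem hμH), ⟨-k, ?_⟩, ?_⟩
        · rw [map_mul, map_inv, hk]
          group
        · have : p₂ μ = 1 := hμ
          rw [map_mul, map_inv, hs, this, inv_one, mul_one]
    · intro f _
      exact ⟨⊤, IsCoC.top hC hne, fun u _ ⟨h, hh, _, hb⟩ => hs ⟨h, hh, hb⟩⟩
  convert SeparableC.iUnion hC hne fun rs : Fin m.natAbs × Fin n.natAbs =>
    key (rs.1 : ℕ) (rs.2 : ℕ) using 1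
  ext f
  simp only [Set.mem_ofPred_eq, Set.mem_iUnion, hca, hcb]
  constructor
  · rintro ⟨h, hh, ⟨i, hi⟩, ⟨j, hj⟩⟩
    have i0 := Int.emod_nonneg i hm
    have i1 := Int.emod_lt i hm
    have j0 := Int.emod_nonneg j hn
    have j1 := Int.emod_lt j hn
    refine ⟨⟨⟨(i % m).toNat, by omega⟩, ⟨(j % n).toNat, by omega⟩⟩, h * x ^ (-(j / n)),
      H.mul_mem hh (H.zpow_mem hx _), ⟨i / m - j / n, ?_⟩, ?_⟩
    · rw [map_mul, map_zpow, ← mul_assoc, hi, hxa, Int.toNat_of_nonneg i0, ← zpow_mul,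
        ← zpow_mul, ← zpow_add, ← zpow_add]
      congr 1
      linear_combination -(Int.mul_ediv_add_emod i m)
    · rw [map_mul, map_zpow, hj, hxb, Int.toNat_of_nonneg j0, ← zpow_mul, ← zpow_add]
      congr 1
      linear_combination -(Int.mul_ediv_add_emod j n)
  · rintro ⟨⟨r, s⟩, h, hh, ⟨k, hk⟩, hb⟩
    refine ⟨h, hh, ⟨(r : ℕ) + m * k, ?_⟩, ⟨_, hb⟩⟩
    rw [hk, hxa, ← zpow_mul, ← zpow_add]

/-- Separation of elements of `H` that agree in the first coordinate and are conjugate in the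
second. -/
theorem exists_isCoC_of_commute_set (hC : IsPseudovariety C) (hCfin : ClassOfFiniteGroups C)
    (hCext : IsExtensionClosed C) (hher₁ : HerConjSepC C F₁) (hher₂ : HerConjSepC C F₂)
    {p₁ : G →* F₁} {p₂ : G →* F₂} (hp₂ : Function.Surjective p₂)
    {H K : Subgroup G} (hK : IsCoC C K) (hKH : K ≤ H) {x y t : G} (ht : t ∈ H)
    (h₁ : p₁ x = p₁ y) (h₂ : p₂ (t * x * t⁻¹) = p₂ y)
    (hsep : SeparableC C
      {f : F₁ | ∃ h ∈ H, Commute (f * p₁ h) (p₁ x) ∧ Commute (p₂ h) (p₂ x)})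
    (hts : p₁ t ∉ {f : F₁ | ∃ h ∈ H, Commute (f * p₁ h) (p₁ x) ∧ Commute (p₂ h) (p₂ x)}) :
    ∃ L : Subgroup G, IsCoC C L ∧ ∀ g ∈ H, g * x * g⁻¹ * y⁻¹ ∉ L := by
  obtain ⟨U, hU, hUS⟩ := hsep _ hts
  obtain ⟨L₁, hL₁, hc₁⟩ := hher₁.centralizer_condition hC hCfin hCext (p₁ x) hU
  obtain ⟨L₂, hL₂, hc₂⟩ := hher₂.centralizer_condition hC hCfin hCext (p₂ x)
    ((hK.inf hC (hU.comap hC p₁)).map hC p₂ hp₂)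
  refine ⟨L₁.comap p₁ ⊓ L₂.comap p₂, (hL₁.comap hC _).inf hC (hL₂.comap hC _), ?_⟩
  rintro g hg ⟨hg₁, hg₂⟩
  replace hg₁ : p₁ (g * x * g⁻¹ * y⁻¹) ∈ L₁ := hg₁
  replace hg₂ : p₂ (g * x * g⁻¹ * y⁻¹) ∈ L₂ := hg₂
  obtain ⟨c₁, hcx₁, u₁, hu₁, e₁⟩ := hc₁ (p₁ g) (by
    simpa only [map_mul, map_inv, h₁] using hg₁)
  obtain ⟨c₂, hcx₂, _, ⟨κ, ⟨hκK, hκU⟩, rfl⟩, e₂⟩ := hc₂ (p₂ (t⁻¹ * g)) (by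
    have := hL₂.normal.conj_mem _ hg₂ (p₂ t)⁻¹
    rw [map_mul, map_inv p₂ y, ← h₂] at this
    simpa [mul_assoc] using this)
  have hκU : p₁ κ ∈ U := hκU
  set h := t⁻¹ * g * κ⁻¹ with hh
  have hhH : h ∈ H := H.mul_mem (H.mul_mem (H.inv_mem ht) hg) (H.inv_mem (hKH hκK))
  have hv : u₁ * (p₁ κ)⁻¹ ∈ U := U.mul_mem hu₁ (U.inv_mem hκU)
  refine hUS (p₁ h * (u₁ * (p₁ κ)⁻¹)⁻¹ * (p₁ h)⁻¹)
    (hU.normal.conj_mem _ (U.inv_mem hv) _) ⟨h, hhH, ?_, ?_⟩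
  · convert hcx₁ using 1
    have : p₁ h = (p₁ t)⁻¹ * (c₁ * u₁) * (p₁ κ)⁻¹ := by
      rw [hh, map_mul, map_mul, e₁, map_inv, map_inv]
    rw [this]
    group
  · convert hcx₂ using 1
    rw [hh, map_mul, e₂, map_inv, mul_inv_cancel_right]

theorem herConjSepC_of_subdirect (hC : IsPseudovariety C) (hCfin : ClassOfFiniteGroups C)
    (hCext : IsExtensionClosed C) (hne : ∃ A, C A)
    (hher₁ : HerConjSepC C F₁) (hher₂ : HerConjSepC C F₂)
    (hcyc₁ : HasCyclicCentralizers F₁) (hcyc₂ : HasCyclicCentralizers F₂)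
    (p₁ : G →* F₁) (p₂ : G →* F₂) (hp₁ : Function.Surjective p₁) (hp₂ : Function.Surjective p₂)
    (hinj : ∀ g h, p₁ g = p₁ h → p₂ g = p₂ h → g = h)
    (N₁ : Subgroup F₁) (hN₁ : N₁ = p₂.ker.map p₁) [N₁.Normal]
    (hhr : HighlyResiduallyC C (F₁ ⧸ N₁)) (hsep : CyclicSubgroupSepC C (F₁ ⧸ N₁)) :
    HerConjSepC C G := by
  intro H hH
  obtain ⟨K, hK, hKH⟩ := hH.exists_isCoC hC hne H.one_mem
  replace hKH : K ≤ H := fun k hk => by simpa using hKH k hk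
  have hKn := hK.normal
  have hsub : ∀ {F' : Type} [Group F'] (p : G →* F'), HerConjSepC C F' →
      Function.Surjective p → ∀ x y : H,
      ¬ IsConj (⟨p x, x, x.2, rfl⟩ : H.map p) ⟨p y, y, y.2, rfl⟩ →
      ∃ L : Subgroup H, IsCoC C L ∧ ∀ g : H, g * x * g⁻¹ * y⁻¹ ∉ L := by
    intro F' _ p hF' hp x y hxy
    obtain ⟨L, hL, h⟩ := (hF' (H.map p)
      ((hK.map hC p hp).cOpen_of_le (Subgroup.map_mono hKH))).exists_isCoC hC hxy
    refine ⟨L.comap (p.subgroupMap H), hL.comap hC _, fun g hg => h (p.subgroupMap H g) ?_⟩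
    convert Subgroup.mem_comap.1 hg using 1
    simp only [map_mul, map_inv]
    rfl
  apply conjSepC_of_exists_isCoC
  intro x y hxy
  by_cases hc₂ : IsConj (⟨p₂ x, x, x.2, rfl⟩ : H.map p₂) ⟨p₂ y, y, y.2, rfl⟩
  swap
  · exact hsub p₂ hher₂ hp₂ x y hc₂
  by_cases hc₁ : IsConj (⟨p₁ x, x, x.2, rfl⟩ : H.map p₁) ⟨p₁ y, y, y.2, rfl⟩
  swap
  · exact hsub p₁ hher₁ hp₁ x y hc₁
  obtain ⟨⟨_, u, hu, rfl⟩, hu₁⟩ := isConj_iff.1 hc₁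
  obtain ⟨⟨_, v, hv, rfl⟩, hv₂⟩ := isConj_iff.1 hc₂
  replace hu₁ : p₁ u * p₁ x * (p₁ u)⁻¹ = p₁ y := congrArg Subtype.val hu₁
  replace hv₂ : p₂ v * p₂ x * (p₂ v)⁻¹ = p₂ y := congrArg Subtype.val hv₂
  set x' : G := u * x * u⁻¹ with hx'
  have hx'H : x' ∈ H := H.mul_mem (H.mul_mem hu x.2) (H.inv_mem hu)
  set t : G := v * u⁻¹ with ht
  have htH : t ∈ H := H.mul_mem hv (H.inv_mem hu)
  have h₁ : p₁ x' = p₁ y := by simpa [hx'] using hu₁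
  have h₂ : p₂ (t * x' * t⁻¹) = p₂ y := by
    rw [← hv₂, hx', ht]
    simp [mul_assoc]
  have hnc : ∀ g ∈ H, g * x' * g⁻¹ ≠ y := by
    intro g hg he
    refine hxy (isConj_iff.2 ⟨⟨g * u, H.mul_mem hg hu⟩, Subtype.ext ?_⟩)
    rw [← he, hx']
    simp [mul_assoc]
  have hts : p₁ t ∉
      {f : F₁ | ∃ h ∈ H, Commute (f * p₁ h) (p₁ x') ∧ Commute (p₂ h) (p₂ x')} := by
    rintro ⟨h, hh, hcom₁, hcom₂⟩
    refine hnc (t * h) (H.mul_mem htH hh) (hinj _ _ ?_ ?_)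
    · rw [← map_mul] at hcom₁
      rw [← h₁, map_mul p₁ (t * h * x'), map_inv, map_mul p₁ (t * h), hcom₁.eq,
        mul_inv_cancel_right]
    · rw [← h₂]
      simp only [map_mul, map_inv, mul_inv_rev]
      rw [mul_assoc (p₂ t), hcom₂.eq]
      group
  have hx₁ : p₁ x' ≠ 1 := by
    intro h
    refine hts ⟨1, H.one_mem, ?_, ?_⟩
    · rw [h]; exact Commute.one_right _
    · rw [map_one]; exact Commute.one_left _
  have hx₂ : p₂ x' ≠ 1 := by
    intro h
    refine hnc 1 H.one_mem (hinj _ _ (by simpa using h₁) ?_)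
    rw [← h₂]
    simp [h]
  have hS : SeparableC C
      {f : F₁ | ∃ h ∈ H, Commute (f * p₁ h) (p₁ x') ∧ Commute (p₂ h) (p₂ x')} := by
    refine separableC_centralizer_product hC hne hcyc₁ hcyc₂ p₁ p₂ H hx'H hx₁ hx₂ ?_
    have hKn₁ : ((K ⊓ p₂.ker).map p₁).Normal := Subgroup.Normal.map inferInstance p₁ hp₁
    refine separableC_zpowers_mul hC hCfin (N := N₁) (K := (K ⊓ p₂.ker).map p₁)
      (Subgroup.map_mono (inf_le_inf_right _ hKH)) ?_ ?_ hhr hsep _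
    · rw [hN₁]
      exact Subgroup.map_mono inf_le_right
    · subst hN₁
      apply IsCoC.map_mk hC
      have hco := (hK.comap hC p₂.ker.subtype).map hC (p₁.subgroupMap p₂.ker)
        (p₁.subgroupMap_surjective p₂.ker)
      convert hco using 1
      ext ⟨z, hz⟩
      rw [Subgroup.mem_subgroupOf]
      constructor
      · rintro ⟨g, ⟨hgK, hg⟩, rfl⟩
        exact ⟨⟨g, hg⟩, hgK, rfl⟩
      · rintro ⟨⟨g, hg⟩, hgK, he⟩
        exact ⟨g, ⟨hgK, hg⟩, congrArg Subtype.val he⟩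
  obtain ⟨L, hL, hLx⟩ := exists_isCoC_of_commute_set hC hCfin hCext hher₁ hher₂ hp₂ hK hKH htH
    h₁ h₂ hS hts
  refine ⟨L.comap H.subtype, hL.comap hC _, fun g hg => ?_⟩
  refine hLx (g * u⁻¹) (H.mul_mem g.2 (H.inv_mem hu)) ?_
  have : (g : G) * x * (g : G)⁻¹ * (y : G)⁻¹ ∈ L := hg
  simpa [hx', mul_assoc] using this

theorem HerConjSepC.subsingleton_of_isEmpty (hne : ¬ ∃ A, C A) (h : HerConjSepC C F₁) (a b : F₁) :
    a = b := by
  have hopen : COpen C ((⊤ : Subgroup F₁) : Set F₁) := by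
    let := ProCTop C F₁
    exact isOpen_univ
  by_contra hab
  obtain ⟨M, hM, -⟩ := h ⊤ hopen ⟨a * b⁻¹, trivial⟩ 1 (by
    rw [isConj_one_left, Subtype.ext_iff]
    simpa [mul_inv_eq_one] using hab)
  exact hne ⟨M, hM⟩

end Subdirect

/-- Corollary 4.5: if moreover `F₁/N₁` is highly
residually-`C` and cyclic subgroup `C`-separable, then the subdirect product `G`
is `C`-hereditarily conjugacy separable. -/
theorem stmt11 (C : GrpB → Prop) (hC : IsPseudovariety C)
    (hCfin : ClassOfFiniteGroups C) (hCext : IsExtensionClosed C)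
    (F₁ F₂ : Type) [Group F₁] [Group F₂]
    (hher₁ : HerConjSepC C F₁) (hher₂ : HerConjSepC C F₂)
    (hcyc₁ : HasCyclicCentralizers F₁) (hcyc₂ : HasCyclicCentralizers F₂)
    (G : Subgroup (F₁ × F₂)) (hG : IsSubdirect G)
    (N₁ : Subgroup F₁) (hN₁ : N₁ = Subgroup.comap (MonoidHom.inl F₁ F₂) G) [N₁.Normal]
    (hhr : HighlyResiduallyC C (F₁ ⧸ N₁))
    (hsep : CyclicSubgroupSepC C (F₁ ⧸ N₁)) :
    HerConjSepC C ↥G := by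
  have hinj : ∀ g h : G, g.1.1 = h.1.1 → g.1.2 = h.1.2 → g = h :=
    fun g h h₁ h₂ => Subtype.ext (Prod.ext h₁ h₂)
  by_cases hne : ∃ A, C A
  · refine herConjSepC_of_subdirect hC hCfin hCext hne hher₁ hher₂ hcyc₁ hcyc₂
      ((MonoidHom.fst F₁ F₂).comp G.subtype) ((MonoidHom.snd F₁ F₂).comp G.subtype)
      ?_ ?_ hinj N₁ ?_ hhr hsep
    · intro f
      obtain ⟨g, hg, rfl⟩ : f ∈ Subgroup.map (MonoidHom.fst F₁ F₂) G := hG.1 ▸ trivial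
      exact ⟨⟨g, hg⟩, rfl⟩
    · intro f
      obtain ⟨g, hg, rfl⟩ : f ∈ Subgroup.map (MonoidHom.snd F₁ F₂) G := hG.2 ▸ trivial
      exact ⟨⟨g, hg⟩, rfl⟩
    · rw [hN₁]
      ext f
      constructor
      · intro hf
        exact ⟨⟨(f, 1), hf⟩, rfl, rfl⟩
      · rintro ⟨⟨⟨f', z⟩, hg⟩, hz, rfl⟩
        obtain rfl : z = 1 := hz
        exact hg
  · intro H _ x y hxy
    refine (hxy ?_).elim
    rw [Subtype.ext (hinj x y (hher₁.subsingleton_of_isEmpty hne _ _)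
      (hher₂.subsingleton_of_isEmpty hne _ _))]
end

section
/- Let 𝒞 be a pseudovariety of groups, let F₁ and F₂ be groups, let ρ₁ : F₁ × F₂ → F₁ be the first-coordinate projection, and let G ≤ F₁ × F₂ be a subgroup with ρ₁(G) = F₁. Set Nᵢ := G ∩ Fᵢ for i = 1, 2. If h₁ ∈ N₁ and h₂ ∈ N₂ are arbitrary elements and x₁ ∈ F₁ belongs to the closure of N₁ in the pro-𝒞 topology on F₁, then the element (x₁h₁x₁⁻¹, h₂) belongs to the closure of the N₁-conjugacy class (h₁,h₂)^{N₁} in the pro-𝒞 topology on G; equivalently, for every M ∈ 𝒞 and every homomorphism φ : G → M, φ((x₁h₁x₁⁻¹, h₂)) ∈ φ((h₁,h₂)^{N₁}). -/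
theorem IsPseudovariety.of_surjective {C : GrpB → Prop} (hC : IsPseudovariety C) {A B : Type}
    [Group A] [Group B] (f : A →* B) (hf : Function.Surjective f) (hA : C (GrpB.of A)) :
    C (GrpB.of B) :=
  let g : (GrpB.of A).carrier →* B := f
  hC.1 _ _ (hC.2.2.2 (GrpB.of A) g.ker hA)
    ⟨(QuotientGroup.quotientKerEquivOfSurjective g hf).symm⟩

theorem IsPseudovariety.of_injective {C : GrpB → Prop} (hC : IsPseudovariety C) {A B : Type}
    [Group A] [Group B] (f : A →* B) (hf : Function.Injective f) (hB : C (GrpB.of B)) :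
    C (GrpB.of A) :=
  hC.1 _ _ (hC.2.1 (GrpB.of B) f.range hB) ⟨MonoidHom.ofInjective hf⟩

theorem IsPseudovariety.isCoC_ker {C : GrpB → Prop} (hC : IsPseudovariety C) {A B : Type}
    [Group A] [Group B] (f : A →* B) (hB : C (GrpB.of B)) : IsCoC C f.ker :=
  ⟨inferInstance, hC.of_injective (QuotientGroup.kerLift f) (QuotientGroup.kerLift_injective f) hB⟩

theorem IsCoC.inf_s12 {C : GrpB → Prop} (hC : IsPseudovariety C) {F : Type} [Group F]
    {N K : Subgroup F} (hN : IsCoC C N) (hK : IsCoC C K) : IsCoC C (N ⊓ K) := by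
  obtain ⟨_, hN⟩ := hN
  obtain ⟨_, hK⟩ := hK
  have h := hC.isCoC_ker ((QuotientGroup.mk' N).prod (QuotientGroup.mk' K))
    (hC.2.2.1 _ _ hN hK)
  rwa [MonoidHom.ker_prod, QuotientGroup.ker_mk', QuotientGroup.ker_mk'] at h

/-- If the surjection `f : A → F` and `φ : A → B` are homomorphisms with `B` in `C`, then
`f (ker φ)` is a co-`C` subgroup of `F`. -/
theorem IsPseudovariety.isCoC_map_ker {C : GrpB → Prop} (hC : IsPseudovariety C) {A B F : Type}
    [Group A] [Group B] [Group F] (φ : A →* B) (hB : C (GrpB.of B)) (f : A →* F)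
    (hf : Function.Surjective f) : IsCoC C (φ.ker.map f) := by
  have hn : (φ.ker.map f).Normal := Subgroup.Normal.map inferInstance f hf
  obtain ⟨_, hA⟩ := hC.isCoC_ker φ hB
  refine ⟨hn, hC.of_surjective
    (QuotientGroup.map φ.ker (φ.ker.map f) f (Subgroup.le_comap_map f φ.ker)) ?_ hA⟩
  exact QuotientGroup.map_surjective_of_surjective _ _ _
    ((QuotientGroup.mk'_surjective _).comp hf) _

/-- The cosets of co-`C` subgroups, with the whole group, form a neighbourhood basis. -/
theorem COpen.eq_univ_or_exists_coset_subset {C : GrpB → Prop} (hC : IsPseudovariety C)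
    {F : Type} [Group F] {U : Set F} (hU : COpen C U) {z : F} (hz : z ∈ U) :
    U = Set.univ ∨ ∃ N : Subgroup F, IsCoC C N ∧ ∀ x, z⁻¹ * x ∈ N → x ∈ U := by
  induction hU with
  | basic s hs =>
    obtain ⟨N, hN, g, rfl⟩ := hs
    refine Or.inr ⟨N, hN, fun x hx => ?_⟩
    have h := N.mul_mem hz hx
    rwa [mul_assoc, mul_inv_cancel_left] at h
  | univ => exact Or.inl rfl
  | inter s t _ _ ihs iht =>
    rcases ihs hz.1 with rfl | ⟨N, hN, hNs⟩
    · simpa using iht hz.2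
    · rcases iht hz.2 with rfl | ⟨K, hK, hKt⟩
      · exact Or.inr ⟨N, hN, fun x hx => ⟨hNs x hx, trivial⟩⟩
      · exact Or.inr ⟨N ⊓ K, hN.inf_s12 hC hK, fun x hx => ⟨hNs x hx.1, hKt x hx.2⟩⟩
  | sUnion S _ ih =>
    obtain ⟨s, hs, hzs⟩ := hz
    rcases ih s hs hzs with rfl | ⟨N, hN, hNs⟩
    · exact Or.inl (Set.eq_univ_of_univ_subset (Set.subset_sUnion_of_mem hs))
    · exact Or.inr ⟨N, hN, fun x hx => ⟨s, hs, hNs x hx⟩⟩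

theorem exists_mem_of_mem_CClosure {C : GrpB → Prop} {F : Type} [Group F] {X : Set F} {x : F}
    (hx : x ∈ CClosure C X) {N : Subgroup F} (hN : IsCoC C N) : ∃ y ∈ X, x⁻¹ * y ∈ N := by
  let := ProCTop C F
  have hopen : IsOpen {y : F | x⁻¹ * y ∈ N} :=
    TopologicalSpace.isOpen_generateFrom_of_mem ⟨N, hN, x, rfl⟩
  obtain ⟨y, hyN, hyX⟩ := mem_closure_iff.mp hx _ hopen (by simp [N.one_mem])
  exact ⟨y, hyX, hyN⟩

theorem mem_CClosure_of_forall_hom {C : GrpB → Prop} (hC : IsPseudovariety C) {F : Type}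
    [Group F] {X : Set F} (hX : X.Nonempty) {z : F}
    (h : ∀ M : GrpB, C M → ∀ φ : F →* M.carrier, φ z ∈ φ '' X) : z ∈ CClosure C X := by
  let := ProCTop C F
  refine mem_closure_iff.mpr fun U hU hz => ?_
  rcases COpen.eq_univ_or_exists_coset_subset hC hU hz with rfl | ⟨N, ⟨_, hN⟩, hNU⟩
  · simpa using hX
  · obtain ⟨y, hyX, hy⟩ := h _ hN (QuotientGroup.mk' N)
    exact ⟨y, hNU y (QuotientGroup.eq.mp hy.symm), hyX⟩

/-- Lemma 4.7: if `x₁` lies in the pro-`C` closure of `N₁` in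
`F₁`, then `(x₁h₁x₁⁻¹, h₂)` lies in the pro-`C` closure (in `G`) of the
`N₁`-conjugacy class of `(h₁, h₂)`; equivalently its image under any homomorphism
to a member of `C` lies in the image of that conjugacy class. -/
theorem stmt12 (C : GrpB → Prop) (hC : IsPseudovariety C)
    (F₁ F₂ : Type) [Group F₁] [Group F₂]
    (G : Subgroup (F₁ × F₂)) (hG : Subgroup.map (MonoidHom.fst F₁ F₂) G = ⊤)
    (N₁ : Subgroup F₁) (hN₁ : N₁ = Subgroup.comap (MonoidHom.inl F₁ F₂) G)
    (N₂ : Subgroup F₂) (hN₂ : N₂ = Subgroup.comap (MonoidHom.inr F₁ F₂) G)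
    (h₁ : F₁) (h₂ : F₂) (hh₁ : h₁ ∈ N₁) (hh₂ : h₂ ∈ N₂)
    (x₁ : F₁) (hx₁ : x₁ ∈ CClosure C (N₁ : Set F₁)) :
    ∃ hmem : ((x₁ * h₁ * x₁⁻¹, h₂) : F₁ × F₂) ∈ G,
      (⟨(x₁ * h₁ * x₁⁻¹, h₂), hmem⟩ : ↥G) ∈
        CClosure C {z : ↥G | ∃ n ∈ N₁,
          (z : F₁ × F₂) = (n, (1 : F₂)) * (h₁, h₂) * (n, (1 : F₂))⁻¹} ∧
      ∀ M : GrpB, C M → ∀ φ : ↥G →* M.carrier,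
        φ ⟨(x₁ * h₁ * x₁⁻¹, h₂), hmem⟩ ∈
          ⇑φ '' {z : ↥G | ∃ n ∈ N₁,
            (z : F₁ × F₂) = (n, (1 : F₂)) * (h₁, h₂) * (n, (1 : F₂))⁻¹} := by
  subst hN₁ hN₂
  let f : ↥G →* F₁ := (MonoidHom.fst F₁ F₂).comp G.subtype
  have hf : Function.Surjective f := fun x => by
    have hx : x ∈ Subgroup.map (MonoidHom.fst F₁ F₂) G := hG ▸ Subgroup.mem_top x
    obtain ⟨g, hg, rfl⟩ := hx
    exact ⟨⟨g, hg⟩, rfl⟩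
  have hh₁G : ((h₁, 1) : F₁ × F₂) ∈ G := hh₁
  have hh₂G : ((1, h₂) : F₁ × F₂) ∈ G := hh₂
  let a : ↥G := ⟨(h₁, 1), hh₁G⟩
  let b : ↥G := ⟨(1, h₂), hh₂G⟩
  have hconj (g : ↥G) :
      ((g * a * g⁻¹ * b : ↥G) : F₁ × F₂) = (f g * h₁ * (f g)⁻¹, h₂) := by
    ext <;> simp [a, b, f]
  obtain ⟨g, rfl⟩ := hf x₁
  have hmem : ((f g * h₁ * (f g)⁻¹, h₂) : F₁ × F₂) ∈ G := hconj g ▸ (g * a * g⁻¹ * b).2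
  have himage : ∀ M : GrpB, C M → ∀ φ : ↥G →* M.carrier,
      φ ⟨(f g * h₁ * (f g)⁻¹, h₂), hmem⟩ ∈
        ⇑φ '' {z : ↥G | ∃ n ∈ Subgroup.comap (MonoidHom.inl F₁ F₂) G,
          (z : F₁ × F₂) = (n, (1 : F₂)) * (h₁, h₂) * (n, (1 : F₂))⁻¹} := by
    intro M hM φ
    obtain ⟨n, hn, k, hk, hkn⟩ := exists_mem_of_mem_CClosure hx₁ (hC.isCoC_map_ker φ hM f hf)
    have hgk : f (g * k) = n := by rw [map_mul, hkn, mul_inv_cancel_left]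
    have hφk : φ k = 1 := hk
    have hg : (⟨(f g * h₁ * (f g)⁻¹, h₂), hmem⟩ : ↥G) = g * a * g⁻¹ * b :=
      Subtype.ext (hconj g).symm
    refine ⟨g * k * a * (g * k)⁻¹ * b, ⟨n, hn, ?_⟩, ?_⟩
    · rw [hconj, hgk]
      simp
    · rw [hg]
      simp [hφk]
  refine ⟨hmem, mem_CClosure_of_forall_hom hC ?_ himage, himage⟩
  refine ⟨a * b, 1, one_mem _, ?_⟩
  simp [a, b]
end
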